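/- arXiv:math/0403475 — 2 statements merged into one kernel-verified Lean document; each statement's English description precedes it below -/
import Mathlib

section
/- Let F be the free group on x_1,...,x_{n+1}, g_k : F → Z/k sending each generator to 1, and F^{(k)} = ker(g_k). Then F^{(k)} is freely generated by the nk+1 elements x_{n+1}^k and τ^j(y_i) for 1 ≤ i ≤ n, 0 ≤ j ≤ k-1, where τ(w) = x_{n+1} w x_{n+1}^{-1} and y_i = x_i x_{n+1}^{-1}. -/
def gk (n k : ℕ) : FreeGroup (Fin (n + 1)) →* Multiplicative (ZMod k) :=
  FreeGroup.lift fun _ => Multiplicative.ofAdd (1 : ZMod k)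

def xlast (n : ℕ) : FreeGroup (Fin (n + 1)) := FreeGroup.of (Fin.last n)

def tau (n : ℕ) (w : FreeGroup (Fin (n + 1))) : FreeGroup (Fin (n + 1)) :=
  xlast n * w * (xlast n)⁻¹

def yy (n : ℕ) (i : Fin n) : FreeGroup (Fin (n + 1)) :=
  FreeGroup.of i.castSucc * (xlast n)⁻¹

namespace KerGk

/-- The homomorphism sending the free generators to `x_{n+1}^k` and the `τ^j(y_i)`. -/
def toFree (n k : ℕ) : FreeGroup (Option (Fin n × Fin k)) →* FreeGroup (Fin (n + 1)) :=
  FreeGroup.lift fun a => a.elim (xlast n ^ k) fun p => (tau n)^[p.2] (yy n p.1)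

theorem tau_iterate (n j : ℕ) (w : FreeGroup (Fin (n + 1))) :
    (tau n)^[j] w = xlast n ^ j * w * (xlast n ^ j)⁻¹ := by
  induction j with
  | zero => simp
  | succ j ih => rw [Function.iterate_succ_apply', ih, tau]; group

@[simp]
theorem toFree_none (n k : ℕ) : toFree n k (FreeGroup.of none) = xlast n ^ k := by
  simp [toFree]

@[simp]
theorem toFree_some (n k : ℕ) (i : Fin n) (j : Fin k) :
    toFree n k (FreeGroup.of (some (i, j))) =
      xlast n ^ (j : ℕ) * yy n i * (xlast n ^ (j : ℕ))⁻¹ := by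
  simp [toFree, tau_iterate]

@[simp]
theorem gk_of (n k : ℕ) (i : Fin (n + 1)) :
    gk n k (FreeGroup.of i) = Multiplicative.ofAdd (1 : ZMod k) := by
  simp [gk]

theorem gk_xlast_pow (n k j : ℕ) :
    gk n k (xlast n ^ j) = Multiplicative.ofAdd (j : ZMod k) := by
  simp [xlast, ← ofAdd_nsmul]

theorem gk_toFree (n k : ℕ) (g : FreeGroup (Option (Fin n × Fin k))) :
    gk n k (toFree n k g) = 1 := by
  suffices h : (gk n k).comp (toFree n k) = 1 from DFunLike.congr_fun h g
  ext a
  rcases a with _ | ⟨i, j⟩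
  · simp [gk_xlast_pow]
  · simp [yy, xlast]

/-- The permutation of the pairs `(j, g)`, read as `x_{n+1}^{-j} * g`, that is left multiplication
by `x_{n+1}⁻¹`. -/
def shift (n m : ℕ) : Equiv.Perm (Fin (m + 1) × FreeGroup (Option (Fin n × Fin (m + 1)))) :=
  Equiv.prodShear (finRotate (m + 1)) fun j =>
    Equiv.mulLeft (if j = Fin.last m then (FreeGroup.of none)⁻¹ else 1)

/-- Left multiplication by `y_i` on the pairs `(j, g)`, read as `x_{n+1}^{-j} * g`. -/
def mulY (n m : ℕ) (i : Fin n) :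
    Equiv.Perm (Fin (m + 1) × FreeGroup (Option (Fin n × Fin (m + 1)))) :=
  Equiv.prodShear (Equiv.refl _) fun j => Equiv.mulLeft (FreeGroup.of (some (i, j)))

/-- The action of the free group on normal forms `(j, g)`. -/
def action (n m : ℕ) : FreeGroup (Fin (n + 1)) →*
    Equiv.Perm (Fin (m + 1) × FreeGroup (Option (Fin n × Fin (m + 1)))) :=
  FreeGroup.lift (Fin.lastCases (shift n m)⁻¹ fun i => mulY n m i * (shift n m)⁻¹)

/-- The element of the free group with normal form `(j, g)`. -/
def ofNormalForm (n m : ℕ) (s : Fin (m + 1) × FreeGroup (Option (Fin n × Fin (m + 1)))) :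
    FreeGroup (Fin (n + 1)) :=
  (xlast n ^ (s.1 : ℕ))⁻¹ * toFree n (m + 1) s.2

variable {n m : ℕ}

theorem shift_of_lt {j : ℕ} (hj : j < m) (g : FreeGroup (Option (Fin n × Fin (m + 1)))) :
    shift n m (⟨j, by omega⟩, g) = (⟨j + 1, by omega⟩, g) := by
  have h : (⟨j, by omega⟩ : Fin (m + 1)) ≠ Fin.last m := by
    simp [Fin.ext_iff, hj.ne]
  simp [shift, h, finRotate_of_lt hj]

theorem shift_last (g : FreeGroup (Option (Fin n × Fin (m + 1)))) :
    shift n m (Fin.last m, g) = (0, (FreeGroup.of none)⁻¹ * g) := by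
  simp [shift]

theorem shift_pow {j : ℕ} (hj : j ≤ m) (g : FreeGroup (Option (Fin n × Fin (m + 1)))) :
    (shift n m ^ j) (0, g) = (⟨j, by omega⟩, g) := by
  induction j with
  | zero => simp
  | succ j ih =>
    rw [pow_succ', Equiv.Perm.mul_apply, ih (by omega), shift_of_lt (by omega)]

theorem shift_pow_succ (g : FreeGroup (Option (Fin n × Fin (m + 1)))) :
    (shift n m ^ (m + 1)) (0, g) = (0, (FreeGroup.of none)⁻¹ * g) := by
  rw [pow_succ', Equiv.Perm.mul_apply, shift_pow le_rfl]
  exact shift_last g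

theorem action_xlast : action n m (xlast n) = (shift n m)⁻¹ := by
  simp [action, xlast]

theorem action_yy (i : Fin n) : action n m (yy n i) = mulY n m i := by
  simp [action, xlast, yy]

theorem ofNormalForm_shift (s : Fin (m + 1) × FreeGroup (Option (Fin n × Fin (m + 1)))) :
    ofNormalForm n m (shift n m s) = (xlast n)⁻¹ * ofNormalForm n m s := by
  obtain ⟨⟨j, hj⟩, g⟩ := s
  rcases Nat.lt_succ_iff_lt_or_eq.mp hj with h | rfl
  · rw [shift_of_lt h]
    simp [ofNormalForm, pow_succ, mul_assoc]
  · have := shift_last g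
    rw [Fin.last] at this
    rw [this]
    simp [ofNormalForm, pow_succ, mul_assoc]

theorem ofNormalForm_mulY (i : Fin n)
    (s : Fin (m + 1) × FreeGroup (Option (Fin n × Fin (m + 1)))) :
    ofNormalForm n m (mulY n m i s) = yy n i * ofNormalForm n m s := by
  simp [ofNormalForm, mulY, mul_assoc]

theorem ofNormalForm_action (w : FreeGroup (Fin (n + 1)))
    (s : Fin (m + 1) × FreeGroup (Option (Fin n × Fin (m + 1)))) :
    ofNormalForm n m (action n m w s) = w * ofNormalForm n m s := by
  have hx : ∀ s, ofNormalForm n m ((shift n m).symm s) = xlast n * ofNormalForm n m s := by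
    intro s
    rw [← inv_mul_eq_iff_eq_mul, ← ofNormalForm_shift, Equiv.apply_symm_apply]
  induction w using FreeGroup.induction_on generalizing s with
  | C1 => simp
  | of i =>
    induction i using Fin.lastCases with
    | last => exact action_xlast (n := n) ▸ hx s
    | cast i => simp [action, ofNormalForm_mulY, hx, yy, mul_assoc]
  | inv_of i ih =>
    rw [eq_inv_mul_iff_mul_eq, ← ih, ← Equiv.Perm.mul_apply, ← map_mul]
    simp
  | mul a b iha ihb => rw [map_mul, Equiv.Perm.mul_apply, iha, ihb, mul_assoc]

theorem action_toFree (h g : FreeGroup (Option (Fin n × Fin (m + 1)))) :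
    action n m (toFree n (m + 1) h) (0, g) = (0, h * g) := by
  induction h using FreeGroup.induction_on generalizing g with
  | C1 => simp
  | of a =>
    rcases a with _ | ⟨i, j⟩
    · rw [toFree_none, map_pow, action_xlast, inv_pow, Equiv.Perm.inv_eq_iff_eq, shift_pow_succ,
        inv_mul_cancel_left]
    · have hj : (j : ℕ) ≤ m := by omega
      simp only [toFree_some, map_mul, map_inv, map_pow, action_xlast, action_yy, inv_pow, inv_inv,
        Equiv.Perm.mul_apply, Equiv.Perm.inv_eq_iff_eq, shift_pow hj]
      simp [mulY]
  | inv_of a ih => rw [map_inv, map_inv, Equiv.Perm.inv_eq_iff_eq, ih, mul_inv_cancel_left]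
  | mul a b iha ihb => rw [map_mul, map_mul, Equiv.Perm.mul_apply, ihb, iha, mul_assoc]

theorem toFree_injective : Function.Injective (toFree n (m + 1)) := by
  refine (injective_iff_map_eq_one _).mpr fun h hh => ?_
  have := action_toFree h 1
  simpa [hh, eq_comm] using this

theorem exists_toFree_eq {w : FreeGroup (Fin (n + 1))} (hw : gk n (m + 1) w = 1) :
    ∃ g, toFree n (m + 1) g = w := by
  have h := ofNormalForm_action (m := m) w (0, 1)
  rcases hs : action n m w (0, 1) with ⟨j, g⟩
  rw [hs] at h
  have h' : (xlast n ^ (j : ℕ))⁻¹ * toFree n (m + 1) g = w := by simpa [ofNormalForm] using h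
  have hj := hw
  rw [← h', map_mul, map_inv, gk_toFree, mul_one, inv_eq_one, gk_xlast_pow, ofAdd_eq_one,
    ZMod.natCast_eq_zero_iff] at hj
  have hj0 : (j : ℕ) = 0 := Nat.eq_zero_of_dvd_of_lt hj j.isLt
  exact ⟨g, by simpa [hj0] using h'⟩

end KerGk

/-- `ker g_k` is freely generated by the `n*k + 1` elements
`x_{n+1}^k` and `τ^j(y_i)`, `1 ≤ i ≤ n`, `0 ≤ j ≤ k-1`. -/
theorem ker_gk_free_basis (n k : ℕ) (hk : 0 < k) :
    ∃ e : FreeGroup (Option (Fin n × Fin k)) ≃* MonoidHom.ker (gk n k),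
      ((e (FreeGroup.of none) : MonoidHom.ker (gk n k)) : FreeGroup (Fin (n + 1)))
          = (xlast n) ^ k ∧
      ∀ (i : Fin n) (j : Fin k),
        ((e (FreeGroup.of (some (i, j))) : MonoidHom.ker (gk n k)) : FreeGroup (Fin (n + 1)))
          = (tau n)^[(j : ℕ)] (yy n i) := by
  obtain ⟨m, rfl⟩ := Nat.exists_eq_succ_of_ne_zero hk.ne'
  refine ⟨MulEquiv.ofBijective ((KerGk.toFree n (m + 1)).codRestrict _
    fun g => MonoidHom.mem_ker.mpr (KerGk.gk_toFree n (m + 1) g)) ⟨?_, ?_⟩, ?_, ?_⟩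
  · exact fun a b h => KerGk.toFree_injective (congrArg Subtype.val h)
  · rintro ⟨w, hw⟩
    obtain ⟨g, hg⟩ := KerGk.exists_toFree_eq (MonoidHom.mem_ker.mp hw)
    exact ⟨g, Subtype.ext hg⟩
  · exact KerGk.toFree_none n (m + 1)
  · intro i j
    rw [KerGk.tau_iterate]
    exact KerGk.toFree_some n (m + 1) i j
end

section
/- Let G be a group with presentation {x_1,...,x_n | r_1,...,r_m} where each r_s is a Wirtinger relator x_i x_p^ε x_i^{-1} x_q^{-ε}, let ĝ_k : G * Z → Z/k send all n+1 generators to 1, and let G^{(k)} = ker(ĝ_k). Then G^{(k)} has a presentation with generators x_{n+1}^k and τ^j(y_i) (1 ≤ i ≤ n, 0 ≤ j ≤ k-1) and relators τ^j(r_s) (1 ≤ s ≤ m, 0 ≤ j ≤ k-1), where τ is conjugation by x_{n+1}, y_i = x_i x_{n+1}^{-1}, and each r_s is rewritten in terms of the y's via x_i x_p x_i^{-1} x_q^{-1} = y_i τ(y_p) τ(y_i^{-1}) y_q^{-1}. -/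
/-- Inclusion `F_n → F_{n+1}` on generators. -/
def incl (n : ℕ) : FreeGroup (Fin n) →* FreeGroup (Fin (n + 1)) :=
  FreeGroup.map Fin.castSucc

/-- The rewriting homomorphism sending the free generator `none` to `x_{n+1}^k`
and the free generator `(i, j)` to `τ^j(y_i)`. -/
def rewr (n k : ℕ) : FreeGroup (Option (Fin n × Fin k)) →* FreeGroup (Fin (n + 1)) :=
  FreeGroup.lift fun o => Option.rec ((xlast n) ^ k)
    (fun p => (tau n)^[(p.2 : ℕ)] (yy n p.1)) o

/-- The rewritten relators `τ^j(r_s)`, `1 ≤ s ≤ m`, `0 ≤ j ≤ k-1`, expressed as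
words in the free generators `x_{n+1}^k`, `τ^j(y_i)`. -/
def rewrRels (n k : ℕ) (rels : Set (FreeGroup (Fin n))) :
    Set (FreeGroup (Option (Fin n × Fin k))) :=
  {w | ∃ r ∈ rels, ∃ j : ℕ, j < k ∧ rewr n k w = (tau n)^[j] (incl n r)}

/-- A group element `t` acts on `Fin k × H`, where `(j, h)` stands for `x⁻ʲ h`, as left
multiplication by a `k`-th root `x` of `t`. -/
def rootPerm {H : Type*} [Group H] {k : ℕ} (hk : 0 < k) (t : H) : Equiv.Perm (Fin k × H) where
  toFun p := if (p.1 : ℕ) = 0 then (⟨k - 1, by omega⟩, t * p.2) else (⟨p.1 - 1, by omega⟩, p.2)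
  invFun p := if h : (p.1 : ℕ) + 1 < k then (⟨p.1 + 1, h⟩, p.2) else (⟨0, hk⟩, t⁻¹ * p.2)
  left_inv := by
    rintro ⟨⟨j, hj⟩, h⟩
    by_cases h0 : j = 0
    · subst h0
      simp [show k - 1 + 1 = k by omega]
    · simp [h0, show j - 1 + 1 = j by omega, hj]
  right_inv := by
    rintro ⟨⟨j, hj⟩, h⟩
    by_cases h0 : j + 1 < k
    · simp [h0]
    · simp [h0, show k - 1 = j by omega]

/-- Left multiplication by `y j` on the fibre over `j`. -/
def fibrePerm {H : Type*} [Group H] {k : ℕ} (y : Fin k → H) : Equiv.Perm (Fin k × H) :=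
  Equiv.prodShear (Equiv.refl _) fun j => Equiv.mulLeft (y j)

/-- The action of `F_{n+1}` on `Fin k × H` induced from elements `f` of `H` indexed by the
generators of the kernel of `F_{n+1} → ℤ/k`. -/
def inducedAction {H : Type*} [Group H] {n k : ℕ} (hk : 0 < k)
    (f : Option (Fin n × Fin k) → H) :
    FreeGroup (Fin (n + 1)) →* Equiv.Perm (Fin k × H) :=
  FreeGroup.lift <| Fin.lastCases (rootPerm hk (f none))
    fun i => fibrePerm (fun j => f (some (i, j))) * rootPerm hk (f none)

section

variable {H : Type*} [Group H] {n k : ℕ} (hk : 0 < k)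

theorem tau_iterate (j : ℕ) (w : FreeGroup (Fin (n + 1))) :
    (tau n)^[j] w = xlast n ^ j * w * (xlast n ^ j)⁻¹ := by
  induction j with
  | zero => simp
  | succ j ih =>
    rw [Function.iterate_succ_apply', ih, tau]
    group

theorem rewr_none : rewr n k (FreeGroup.of none) = xlast n ^ k := by
  simp [rewr]

theorem rewr_some (i : Fin n) (j : Fin k) :
    rewr n k (FreeGroup.of (some (i, j))) = xlast n ^ (j : ℕ) * yy n i * (xlast n ^ (j : ℕ))⁻¹ := by
  simp [rewr, tau_iterate]

theorem rootPerm_zero (t h : H) :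
    rootPerm hk t (⟨0, hk⟩, h) = (⟨k - 1, by omega⟩, t * h) := by
  simp [rootPerm]

theorem rootPerm_succ (t h : H) (j : ℕ) (hj : j + 1 < k) :
    rootPerm hk t (⟨j + 1, hj⟩, h) = (⟨j, by omega⟩, h) := by
  simp [rootPerm]

theorem rootPerm_pow (t h : H) (j : ℕ) (hj : j < k) :
    (rootPerm hk t ^ j) (⟨j, hj⟩, h) = (⟨0, hk⟩, h) := by
  induction j with
  | zero => simp
  | succ j ih => rw [pow_succ, Equiv.Perm.mul_apply, rootPerm_succ, ih]

theorem rootPerm_pow_inv (t h : H) (j : Fin k) :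
    (rootPerm hk t ^ (j : ℕ))⁻¹ (⟨0, hk⟩, h) = (j, h) := by
  rw [Equiv.Perm.inv_eq_iff_eq, rootPerm_pow hk t h j j.2]

theorem rootPerm_pow_self (t h : H) :
    (rootPerm hk t ^ k) (⟨0, hk⟩, h) = (⟨0, hk⟩, t * h) := by
  obtain ⟨m, rfl⟩ := Nat.exists_eq_add_of_lt hk
  rw [pow_succ, Equiv.Perm.mul_apply, rootPerm_zero]
  exact rootPerm_pow hk t (t * h) _ _

theorem fibrePerm_apply (y : Fin k → H) (j : Fin k) (h : H) :
    fibrePerm y (j, h) = (j, y j * h) := rfl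

variable (f : Option (Fin n × Fin k) → H)

theorem inducedAction_xlast : inducedAction hk f (xlast n) = rootPerm hk (f none) := by
  simp [inducedAction, xlast]

theorem inducedAction_castSucc (i : Fin n) :
    inducedAction hk f (FreeGroup.of i.castSucc) =
      fibrePerm (fun j => f (some (i, j))) * rootPerm hk (f none) := by
  simp [inducedAction]

theorem inducedAction_yy (i : Fin n) :
    inducedAction hk f (yy n i) = fibrePerm (fun j => f (some (i, j))) := by
  rw [yy, map_mul, map_inv, inducedAction_xlast, inducedAction_castSucc, mul_inv_cancel_right]

/-- Over the base point, the kernel acts by left multiplication. -/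
theorem inducedAction_rewr (w : FreeGroup (Option (Fin n × Fin k))) (h : H) :
    inducedAction hk f (rewr n k w) (⟨0, hk⟩, h) = (⟨0, hk⟩, FreeGroup.lift f w * h) := by
  have key : ∀ o h, inducedAction hk f (rewr n k (FreeGroup.of o)) (⟨0, hk⟩, h) =
      (⟨0, hk⟩, f o * h) := by
    rintro (_ | ⟨i, j⟩) h
    · rw [rewr_none, map_pow, inducedAction_xlast, rootPerm_pow_self]
    · simp only [rewr_some, map_mul, map_inv, map_pow, inducedAction_xlast, inducedAction_yy,
        Equiv.Perm.mul_apply, rootPerm_pow_inv, fibrePerm_apply]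
      exact rootPerm_pow hk _ _ _ j.2
  induction w using FreeGroup.induction_on generalizing h with
  | C1 => simp
  | of o => simpa using key o h
  | inv_of o _ =>
    rw [map_inv, map_inv, Equiv.Perm.inv_eq_iff_eq, key]
    simp
  | mul a b ha hb => rw [map_mul, map_mul, Equiv.Perm.mul_apply, hb, ha, map_mul, mul_assoc]

/-- The map `(j, w) ↦ x⁻ʲ w` is equivariant. -/
theorem inducedAction_of_equivariant (g : FreeGroup (Fin (n + 1)))
    (p : Fin k × FreeGroup (Option (Fin n × Fin k))) :
    (xlast n ^ ((inducedAction hk FreeGroup.of g p).1 : ℕ))⁻¹ *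
        rewr n k (inducedAction hk FreeGroup.of g p).2 =
      g * ((xlast n ^ (p.1 : ℕ))⁻¹ * rewr n k p.2) := by
  have hroot : ∀ p : Fin k × FreeGroup (Option (Fin n × Fin k)),
      (xlast n ^ ((rootPerm hk (FreeGroup.of none) p).1 : ℕ))⁻¹ *
        rewr n k (rootPerm hk (FreeGroup.of none) p).2 =
      xlast n * ((xlast n ^ (p.1 : ℕ))⁻¹ * rewr n k p.2) := by
    rintro ⟨⟨_ | j, hj⟩, w⟩
    · obtain ⟨m, rfl⟩ := Nat.exists_eq_add_of_lt hk
      rw [rootPerm_zero]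
      simp [rewr_none, pow_succ']
      group
    · rw [rootPerm_succ]
      simp [pow_succ, mul_assoc]
  have key : ∀ i p, (xlast n ^ ((inducedAction hk FreeGroup.of (FreeGroup.of i) p).1 : ℕ))⁻¹ *
        rewr n k (inducedAction hk FreeGroup.of (FreeGroup.of i) p).2 =
      FreeGroup.of i * ((xlast n ^ (p.1 : ℕ))⁻¹ * rewr n k p.2) := by
    intro i p
    induction i using Fin.lastCases with
    | last =>
      have := hroot p
      rwa [← inducedAction_xlast] at this
    | cast i =>
      rw [inducedAction_castSucc, Equiv.Perm.mul_apply]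
      have := hroot p
      generalize rootPerm hk (FreeGroup.of none) p = q at this ⊢
      obtain ⟨j, w⟩ := q
      rw [fibrePerm_apply, map_mul, rewr_some]
      rw [← inv_mul_eq_iff_eq_mul] at this
      rw [← this, yy]
      group
  induction g using FreeGroup.induction_on generalizing p with
  | C1 => simp
  | of i => exact key i p
  | inv_of i _ =>
    rw [eq_inv_mul_iff_mul_eq, ← key, map_inv, ← Equiv.Perm.mul_apply, mul_inv_cancel, Equiv.Perm.one_apply]
  | mul a b ha hb => rw [map_mul, Equiv.Perm.mul_apply, ha, hb, mul_assoc]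

end

theorem exists_eq_xlast_pow_inv_mul_rewr {n k : ℕ} (hk : 0 < k) (g : FreeGroup (Fin (n + 1))) :
    ∃ (j : Fin k) (w : FreeGroup (Option (Fin n × Fin k))),
      g = (xlast n ^ (j : ℕ))⁻¹ * rewr n k w :=
  ⟨_, _, by simpa using (inducedAction_of_equivariant hk g (⟨0, hk⟩, 1)).symm⟩

theorem map_rewr_eq_one {n k : ℕ} (d : FreeGroup (Fin (n + 1)) →* Multiplicative (ZMod k))
    (hd : ∀ i, d (FreeGroup.of i) = Multiplicative.ofAdd 1)
    (w : FreeGroup (Option (Fin n × Fin k))) : d (rewr n k w) = 1 := by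
  suffices h : d.comp (rewr n k) = 1 from DFunLike.congr_fun h w
  ext o
  rcases o with _ | ⟨i, j⟩
  · simp [rewr_none, xlast, hd, ← ofAdd_nsmul]
  · simp [rewr_some, yy, xlast, hd]

/-- If `d` sends every generator to `1`, then its kernel lies in the range of `rewr`. -/
theorem exists_rewr_eq {n k : ℕ} (hk : 0 < k)
    (d : FreeGroup (Fin (n + 1)) →* Multiplicative (ZMod k))
    (hd : ∀ i, d (FreeGroup.of i) = Multiplicative.ofAdd 1)
    (g : FreeGroup (Fin (n + 1))) (hg : d g = 1) : ∃ w, rewr n k w = g := by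
  obtain ⟨j, w, rfl⟩ := exists_eq_xlast_pow_inv_mul_rewr hk g
  refine ⟨w, ?_⟩
  rw [map_mul, map_rewr_eq_one d hd, mul_one, map_inv, map_pow, xlast, hd, inv_eq_one,
    ← ofAdd_nsmul, ofAdd_eq_one, nsmul_one, ZMod.natCast_eq_zero_iff] at hg
  simp [Nat.eq_zero_of_dvd_of_lt hg j.2]

/-- for a group `G` with Wirtinger-type relators `rels`, the kernel
`G^{(k)}` of `ĝ_k : G ∗ ℤ → Z/k` has the presentation with generators `x_{n+1}^k`
and `τ^j(y_i)` and relators the rewritten `τ^j(r_s)`. -/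
theorem ker_ghat_presentation (n k : ℕ) (hk : 0 < k)
    (rels : Set (FreeGroup (Fin n)))
    (hwirt : ∀ r ∈ rels, ∃ (i p q : Fin n) (ε : ℤ), (ε = 1 ∨ ε = -1) ∧
      r = FreeGroup.of i * (FreeGroup.of p) ^ ε * (FreeGroup.of i)⁻¹ *
        (FreeGroup.of q) ^ (-ε))
    (ghat : Monoid.Coprod (PresentedGroup rels) (Multiplicative ℤ) →*
      Multiplicative (ZMod k))
    (hgen : ∀ i : Fin n, ghat (Monoid.Coprod.inl (PresentedGroup.of i)) =
      Multiplicative.ofAdd (1 : ZMod k))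
    (hlast : ghat (Monoid.Coprod.inr (Multiplicative.ofAdd (1 : ℤ))) =
      Multiplicative.ofAdd (1 : ZMod k)) :
    ∃ e : PresentedGroup (rewrRels n k rels) ≃* MonoidHom.ker ghat,
      (∀ w : MonoidHom.ker ghat,
        (w : Monoid.Coprod (PresentedGroup rels) (Multiplicative ℤ)) =
          (Monoid.Coprod.inr (Multiplicative.ofAdd (1 : ℤ))) ^ k →
        e (PresentedGroup.of none) = w) ∧
      ∀ (i : Fin n) (j : Fin k) (w : MonoidHom.ker ghat),
        (w : Monoid.Coprod (PresentedGroup rels) (Multiplicative ℤ)) =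
          (fun v => Monoid.Coprod.inr (Multiplicative.ofAdd (1 : ℤ)) * v *
            (Monoid.Coprod.inr (Multiplicative.ofAdd (1 : ℤ)))⁻¹)^[(j : ℕ)]
            (Monoid.Coprod.inl (PresentedGroup.of i) *
              (Monoid.Coprod.inr (Multiplicative.ofAdd (1 : ℤ)))⁻¹) →
        e (PresentedGroup.of (some (i, j))) = w := by
  let x : Monoid.Coprod (PresentedGroup rels) (Multiplicative ℤ) :=
    Monoid.Coprod.inr (Multiplicative.ofAdd (1 : ℤ))
  let π : FreeGroup (Fin (n + 1)) →* Monoid.Coprod (PresentedGroup rels) (Multiplicative ℤ) :=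
    FreeGroup.lift (Fin.lastCases x fun i => Monoid.Coprod.inl (PresentedGroup.of i))
  have πlast : π (xlast n) = x := by simp [π, xlast]
  have πcast : ∀ i : Fin n, π (FreeGroup.of i.castSucc) =
      Monoid.Coprod.inl (PresentedGroup.of i) := fun i => by simp [π]
  have πincl : ∀ r, π (incl n r) = Monoid.Coprod.inl (PresentedGroup.mk rels r) := by
    intro r
    suffices h : π.comp (incl n) = Monoid.Coprod.inl.comp (PresentedGroup.mk rels) from
      DFunLike.congr_fun h r
    ext i
    simp only [MonoidHom.comp_apply, incl, FreeGroup.map.of, πcast]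
    rfl
  have hd : ∀ i, (ghat.comp π) (FreeGroup.of i) = Multiplicative.ofAdd 1 := by
    intro i
    induction i using Fin.lastCases with
    | last => rw [MonoidHom.comp_apply, ← xlast, πlast, hlast]
    | cast i => rw [MonoidHom.comp_apply, πcast, hgen]
  have πsurj : Function.Surjective π := by
    rw [← MonoidHom.range_eq_top, eq_top_iff, ← Monoid.Coprod.range_inl_sup_range_inr, sup_le_iff]
    constructor
    · rintro _ ⟨g, rfl⟩
      obtain ⟨r, rfl⟩ := PresentedGroup.mk_surjective rels g
      exact ⟨incl n r, πincl r⟩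
    · rintro _ ⟨z, rfl⟩
      refine ⟨xlast n ^ z.toAdd, ?_⟩
      rw [map_zpow, πlast, ← map_zpow, ← ofAdd_zsmul]
      simp
  have πrels : ∀ w ∈ rewrRels n k rels, π (rewr n k w) = 1 := by
    rintro w ⟨r, hr, j, -, hw⟩
    rw [hw, tau_iterate, map_mul, map_mul, πincl,
      PresentedGroup.one_of_mem hr]
    simp
  let Φ₀ : FreeGroup (Option (Fin n × Fin k)) →* ghat.ker :=
    (π.comp (rewr n k)).codRestrict ghat.ker fun w => map_rewr_eq_one (ghat.comp π) hd w
  have hΦ₀ : ∀ w, FreeGroup.lift (fun o => Φ₀ (FreeGroup.of o)) w = Φ₀ w := fun w =>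
    DFunLike.congr_fun (FreeGroup.lift.apply_symm_apply Φ₀) w
  let Φ : PresentedGroup (rewrRels n k rels) →* ghat.ker :=
    PresentedGroup.toGroup (f := fun o => Φ₀ (FreeGroup.of o)) fun w hw => by
      rw [hΦ₀]
      exact Subtype.ext (πrels w hw)
  have hΦ : ∀ w, (Φ (PresentedGroup.mk _ w) :
      Monoid.Coprod (PresentedGroup rels) (Multiplicative ℤ)) = π (rewr n k w) :=
    fun w => congrArg Subtype.val (hΦ₀ w)
  have Φsurj : Function.Surjective Φ := by
    rintro ⟨z, hz⟩
    obtain ⟨g, rfl⟩ := πsurj z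
    obtain ⟨w, rfl⟩ := exists_rewr_eq hk (ghat.comp π) hd g hz
    exact ⟨PresentedGroup.mk _ w, Subtype.ext (hΦ w)⟩
  have drels : ∀ r ∈ rels, ghat (π (incl n r)) = 1 := by
    intro r hr
    rw [πincl, PresentedGroup.one_of_mem hr, map_one, map_one]
  let A := inducedAction hk (PresentedGroup.of (rels := rewrRels n k rels))
  have Alast : A (xlast n) = rootPerm hk (PresentedGroup.of none) := inducedAction_xlast hk _
  have Arewr : ∀ w h, A (rewr n k w) (⟨0, hk⟩, h) =
      (⟨0, hk⟩, PresentedGroup.mk _ w * h) := by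
    intro w h
    rw [inducedAction_rewr]
    congr 2
    exact DFunLike.congr_fun (FreeGroup.lift.apply_symm_apply
      (PresentedGroup.mk (rewrRels n k rels))) w
  have Arels : ∀ r ∈ rels, A (incl n r) = 1 := by
    intro r hr
    ext1 ⟨j, h⟩
    obtain ⟨w, hw⟩ := exists_rewr_eq hk (ghat.comp π) hd ((tau n)^[j] (incl n r)) (by
      rw [tau_iterate, map_mul, map_mul, MonoidHom.comp_apply _ _ (incl n r), drels r hr]
      simp)
    have hw1 : PresentedGroup.mk (rewrRels n k rels) w = 1 :=
      PresentedGroup.one_of_mem ⟨r, hr, j, j.2, hw⟩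
    have h1 := Arewr w h
    rw [hw1, one_mul, hw, tau_iterate, map_mul, map_mul, map_inv, map_pow, Alast,
      Equiv.Perm.mul_apply, Equiv.Perm.mul_apply, rootPerm_pow_inv, ← Equiv.Perm.eq_inv_iff_eq,
      rootPerm_pow_inv] at h1
    exact h1
  let B : Monoid.Coprod (PresentedGroup rels) (Multiplicative ℤ) →*
      Equiv.Perm (Fin k × PresentedGroup (rewrRels n k rels)) :=
    Monoid.Coprod.lift
      (PresentedGroup.toGroup (f := fun i => A (incl n (FreeGroup.of i))) fun r hr => by
        rw [← Arels r hr]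
        exact DFunLike.congr_fun (FreeGroup.lift.apply_symm_apply (A.comp (incl n))) r)
      (zpowersHom _ (A (xlast n)))
  have hB : ∀ g, B (π g) = A g := by
    intro g
    suffices h : B.comp π = A from DFunLike.congr_fun h g
    ext1 i
    induction i using Fin.lastCases with
    | last =>
      rw [MonoidHom.comp_apply, ← xlast, πlast]
      simp [B, x]
    | cast i =>
      rw [MonoidHom.comp_apply, πcast]
      simp [B, incl]
  have Φinj : Function.Injective Φ := by
    rw [injective_iff_map_eq_one]
    intro z hz
    obtain ⟨w, rfl⟩ := PresentedGroup.mk_surjective _ z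
    have h1 := Arewr w 1
    rw [← hB, ← hΦ, hz] at h1
    simpa using (congrArg Prod.snd h1).symm
  refine ⟨MulEquiv.ofBijective Φ ⟨Φinj, Φsurj⟩, fun w hw => Subtype.ext ?_,
    fun i j w hw => Subtype.ext ?_⟩
  · rw [hw]
    refine (hΦ (FreeGroup.of none)).trans ?_
    rw [rewr_none, map_pow, πlast]
  · rw [hw]
    refine (hΦ (FreeGroup.of (some (i, j)))).trans ?_
    have hit : ∀ (m : ℕ) (u : FreeGroup (Fin (n + 1))),
        π ((tau n)^[m] u) = (fun v => x * v * x⁻¹)^[m] (π u) := fun m u =>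
      Function.Semiconj.iterate_right
        (fun u => by rw [tau, map_mul, map_mul, map_inv, πlast]) m u
    rw [rewr_some, ← tau_iterate, hit, yy, map_mul, map_inv, πlast, πcast]
end
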